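/- arXiv:0911.3069 — 4 statements merged into one kernel-verified Lean document; each statement's English description precedes it below -/
import Mathlib

section
/- For every integer n ≥ 1 and every s, the Bernoulli polynomials satisfy B_n(s) = s·B_{n-1}(s) - (1/n) ∑_{k=1}^{n} C(n,k) (-1)^k B_k B_{n-k}(s). -/
/-- The Bernoulli polynomial `B_n(s)`, evaluated at a real number `s`
(Mathlib's `Polynomial.bernoulli` has rational coefficients and satisfies
`t e^{st}/(e^t-1) = ∑ B_n(s) tⁿ/n!`, with `B_n(0) = bernoulli n`, `B₁ = -1/2`). -/
noncomputable def bernoulliPolyEval (n : ℕ) (s : ℝ) : ℝ :=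
  Polynomial.aeval s (Polynomial.bernoulli n)

section

open PowerSeries

/-- The exponential generating function of `n ↦ B_n(s)`. -/
noncomputable def bernoulliPolyEvalPowerSeries (s : ℝ) : ℝ⟦X⟧ :=
  PowerSeries.mk fun n => bernoulliPolyEval n s / (n.factorial : ℝ)

theorem bernoulliPolyEvalPowerSeries_mul_exp_sub_one (s : ℝ) :
    bernoulliPolyEvalPowerSeries s * (exp ℝ - 1) = X * rescale s (exp ℝ) := by
  rw [← Polynomial.bernoulli_generating_function]
  congr 1
  ext n
  simp [bernoulliPolyEvalPowerSeries, bernoulliPolyEval, Algebra.smul_def, div_eq_inv_mul]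

theorem derivative_rescale_exp (s : ℝ) :
    d⁄dX ℝ (rescale s (exp ℝ)) = C s * rescale s (exp ℝ) := by
  ext n
  have h : (n.factorial : ℝ) ≠ 0 := by positivity
  have h' : (n : ℝ) + 1 ≠ 0 := by positivity
  simp only [coeff_derivative, coeff_rescale, coeff_exp, coeff_C_mul, Nat.factorial_succ]
  push_cast
  simp
  field_simp
  exact pow_succ' s n

/-- The differential equation satisfied by the generating function of `B_n(s)`. -/
theorem X_mul_derivative_bernoulliPolyEvalPowerSeries (s : ℝ) :
    X * d⁄dX ℝ (bernoulliPolyEvalPowerSeries s)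
        + bernoulli'PowerSeries ℝ * bernoulliPolyEvalPowerSeries s
      = bernoulliPolyEvalPowerSeries s + C s * (X * bernoulliPolyEvalPowerSeries s) := by
  have hF := bernoulliPolyEvalPowerSeries_mul_exp_sub_one s
  have hB := bernoulli'PowerSeries_mul_exp_sub_one ℝ
  have hD := congrArg (d⁄dX ℝ) hF
  have hexp : d⁄dX ℝ (exp ℝ) = exp ℝ := by
    simpa [rescale_one] using derivative_rescale_exp 1
  simp only [Derivation.leibniz, map_sub, smul_eq_mul, derivative_rescale_exp, hexp,
    Derivation.map_one_eq_zero, derivative_X, sub_zero] at hD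
  have hne : (exp ℝ - 1 : ℝ⟦X⟧) ≠ 0 := by
    intro h
    have := congrArg (coeff 1) h
    simp [coeff_exp, coeff_one] at this
  apply mul_right_cancel₀ hne
  linear_combination X * hD + bernoulliPolyEvalPowerSeries s * hB - (1 + C s * X) * hF

end

/-- For every integer `n ≥ 1` and every `s`,
`B_n(s) = s·B_{n-1}(s) - (1/n) ∑_{k=1}^{n} C(n,k) (-1)^k B_k B_{n-k}(s)`. -/
theorem bernoulliPoly_recurrence_alt (n : ℕ) (hn : 1 ≤ n) (s : ℝ) :
    bernoulliPolyEval n s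
      = s * bernoulliPolyEval (n - 1) s
        - (1 / (n : ℝ)) * ∑ k ∈ Finset.Icc 1 n,
            (n.choose k : ℝ) * (-1) ^ k * (bernoulli k : ℝ) * bernoulliPolyEval (n - k) s := by
  obtain ⟨m, rfl⟩ := Nat.exists_eq_add_of_le' hn
  have h := congrArg (PowerSeries.coeff (m + 1))
    (X_mul_derivative_bernoulliPolyEvalPowerSeries s)
  have hsum : ∑ k ∈ Finset.Icc 1 (m + 1), ((m + 1).choose k : ℝ) * (-1) ^ k * (bernoulli k : ℝ)
        * bernoulliPolyEval (m + 1 - k) s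
      = ((m + 1).factorial : ℝ) * PowerSeries.coeff (m + 1)
          (bernoulli'PowerSeries ℝ * bernoulliPolyEvalPowerSeries s)
        - bernoulliPolyEval (m + 1) s := by
    rw [PowerSeries.coeff_mul, Finset.Nat.sum_antidiagonal_eq_sum_range_succ_mk, Finset.mul_sum,
      Finset.range_eq_Ico, Finset.sum_eq_sum_Ico_succ_bot (Nat.succ_pos _)]
    have h0 : ((m + 1).factorial : ℝ) ≠ 0 := by positivity
    simp only [bernoulli'PowerSeries, bernoulliPolyEvalPowerSeries, PowerSeries.coeff_mk,
      bernoulli'_eq_bernoulli]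
    rw [eq_sub_iff_add_eq, add_comm]
    congr 1
    · simp
      field_simp
    · refine Finset.sum_congr rfl fun k hk => ?_
      have hk' : k ≤ m + 1 := by simp at hk; omega
      rw [Nat.cast_choose ℝ hk']
      simp
      field_simp
  have h0 : (m.factorial : ℝ) ≠ 0 := by positivity
  have h1 : (m : ℝ) + 1 ≠ 0 := by positivity
  rw [map_add, map_add, PowerSeries.coeff_succ_X_mul, PowerSeries.coeff_C_mul,
    PowerSeries.coeff_succ_X_mul, PowerSeries.coeff_derivative, ← eq_sub_iff_add_eq'] at h
  rw [hsum, h]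
  simp only [bernoulliPolyEvalPowerSeries, PowerSeries.coeff_mk, Nat.factorial_succ,
    Nat.add_sub_cancel]
  push_cast
  field_simp
  ring
end

section
/- For every integer n ≥ 1 and every s, the Bernoulli polynomials satisfy B_n(s) = (s-1)·B_{n-1}(s) - (1/n) ∑_{k=1}^{n} C(n,k) B_k B_{n-k}(s). -/
namespace PowerSeries

open scoped Nat

theorem derivative_rescale {R : Type*} [CommSemiring R] (a : R) (f : R⟦X⟧) :
    derivative R (rescale a f) = C a * rescale a (derivative R f) := by
  ext n
  simp only [coeff_derivative, coeff_rescale, coeff_C_mul]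
  ring

theorem exp_sub_one_ne_zero (A : Type*) [Ring A] [Algebra ℚ A] [Nontrivial A] :
    exp A - 1 ≠ 0 := by
  intro h
  simpa [coeff_exp, coeff_one] using congrArg (coeff 1) h

variable {A : Type*} [CommRing A] [Algebra ℚ A]

/-- The exponential generating function `∑ B_n(a) Xⁿ / n!` of the Bernoulli polynomials at `a`. -/
noncomputable def bernoulliPolySeries (a : A) : A⟦X⟧ :=
  mk fun n => Polynomial.aeval a ((1 / n ! : ℚ) • Polynomial.bernoulli n)

/-- The differential equation in `X` satisfied by `X e^{aX} / (e^X - 1)`. -/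
theorem X_mul_derivative_bernoulliPolySeries [IsDomain A] (a : A) :
    X * derivative A (bernoulliPolySeries a) =
      bernoulliPolySeries a + (C a - 1) * (X * bernoulliPolySeries a) -
        bernoulliPowerSeries A * bernoulliPolySeries a := by
  have hF : bernoulliPolySeries a * (exp A - 1) = X * rescale a (exp A) :=
    Polynomial.bernoulli_generating_function a
  have hb := bernoulliPowerSeries_mul_exp_sub_one A
  have hD := congrArg (derivative A) hF
  simp only [Derivation.leibniz, map_sub, derivative_exp, derivative_rescale, derivative_X,
    derivative_one, smul_eq_mul] at hD
  refine mul_right_cancel₀ (exp_sub_one_ne_zero A) ?_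
  linear_combination X * hD + bernoulliPolySeries a * hb - (1 + C a * X) * hF

end PowerSeries

theorem natCast_mul_bernoulliPolyEval {n : ℕ} (hn : 1 ≤ n) (s : ℝ) :
    (n : ℝ) * bernoulliPolyEval n s
      = bernoulliPolyEval n s + (s - 1) * (n * bernoulliPolyEval (n - 1) s)
        - ∑ k ∈ Finset.range (n + 1),
            (n.choose k : ℝ) * (bernoulli k : ℝ) * bernoulliPolyEval (n - k) s := by
  obtain ⟨m, rfl⟩ : ∃ m, n = m + 1 := ⟨n - 1, by omega⟩
  have hcoeff (k : ℕ) : PowerSeries.coeff k (PowerSeries.bernoulliPolySeries s) =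
      bernoulliPolyEval k s / (k.factorial : ℝ) := by
    simp [PowerSeries.bernoulliPolySeries, bernoulliPolyEval, Algebra.smul_def, div_eq_inv_mul]
  have h := congrArg (PowerSeries.coeff (m + 1))
    (PowerSeries.X_mul_derivative_bernoulliPolySeries s)
  have hconst : (PowerSeries.C s - 1 : PowerSeries ℝ) = PowerSeries.C (s - 1) := by simp
  rw [hconst, map_sub, map_add, PowerSeries.coeff_succ_X_mul, PowerSeries.coeff_derivative,
    PowerSeries.coeff_C_mul, PowerSeries.coeff_succ_X_mul, PowerSeries.coeff_mul,
    Finset.Nat.sum_antidiagonal_eq_sum_range_succ_mk] at h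
  simp only [hcoeff, bernoulliPowerSeries, PowerSeries.coeff_mk] at h
  have hsum : ∑ k ∈ Finset.range (m + 1 + 1), ((m + 1).choose k : ℝ) * (bernoulli k : ℝ) *
        bernoulliPolyEval (m + 1 - k) s =
      ((m + 1).factorial : ℝ) * ∑ k ∈ Finset.range (m + 1 + 1),
        algebraMap ℚ ℝ (bernoulli k / (k.factorial : ℚ)) *
          (bernoulliPolyEval (m + 1 - k) s / ((m + 1 - k).factorial : ℝ)) := by
    rw [Finset.mul_sum]
    refine Finset.sum_congr rfl fun k hk => ?_
    rw [Nat.cast_choose ℝ (Finset.mem_range_succ_iff.mp hk)]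
    simp only [map_div₀, map_natCast, eq_ratCast]
    field_simp
  have hfact : ((m + 1).factorial : ℝ) = (m + 1) * m.factorial := by
    push_cast [Nat.factorial_succ]; ring
  have hm : (m.factorial : ℝ) ≠ 0 := by positivity
  rw [hsum, Nat.add_sub_cancel, ← sub_eq_zero]
  rw [← sub_eq_zero] at h
  rw [← mul_zero ((m + 1).factorial : ℝ), ← h, hfact]
  push_cast
  field_simp

/-- For every integer `n ≥ 1` and every `s`,
`B_n(s) = (s-1)·B_{n-1}(s) - (1/n) ∑_{k=1}^{n} C(n,k) B_k B_{n-k}(s)`. -/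
theorem bernoulliPoly_recurrence (n : ℕ) (hn : 1 ≤ n) (s : ℝ) :
    bernoulliPolyEval n s
      = (s - 1) * bernoulliPolyEval (n - 1) s
        - (1 / (n : ℝ)) * ∑ k ∈ Finset.Icc 1 n,
            (n.choose k : ℝ) * (bernoulli k : ℝ) * bernoulliPolyEval (n - k) s := by
  have h := natCast_mul_bernoulliPolyEval hn s
  have hn' : (n : ℝ) ≠ 0 := by positivity
  rw [Finset.range_eq_Ico, Finset.sum_eq_sum_Ico_succ_bot (Nat.add_one_pos n),
    Finset.Ico_add_one_right_eq_Icc] at h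
  simp only [Nat.choose_zero_right, bernoulli_zero, Nat.cast_one, Rat.cast_one, one_mul,
    Nat.sub_zero, zero_add] at h
  field_simp
  linear_combination h
end

section
/- (Euler's identity) For every integer n ≥ 1, the Bernoulli numbers satisfy B_n = -B_{n-1} - (1/n) ∑_{k=1}^{n} C(n,k) B_k B_{n-k}. -/
open PowerSeries in
/-- The differential equation `X dB/dX + X B + B² = B` satisfied by the exponential generating
function `B` of the Bernoulli numbers. -/
theorem X_mul_derivative_bernoulliPowerSeries :
    X * d⁄dX ℚ (bernoulliPowerSeries ℚ) + X * bernoulliPowerSeries ℚ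
      + bernoulliPowerSeries ℚ * bernoulliPowerSeries ℚ = bernoulliPowerSeries ℚ := by
  have h := bernoulliPowerSeries_mul_exp_sub_one ℚ
  have hd := congrArg (d⁄dX ℚ) h
  simp only [Derivation.leibniz, map_sub, derivative_exp, derivative_one, derivative_X,
    smul_eq_mul, sub_zero] at hd
  linear_combination bernoulliPowerSeries ℚ * hd -
    (d⁄dX ℚ (bernoulliPowerSeries ℚ) + bernoulliPowerSeries ℚ) * h

/-- The binomial self-convolution of the Bernoulli numbers. -/
theorem sum_choose_mul_bernoulli_mul_bernoulli (m : ℕ) :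
    ∑ k ∈ Finset.range (m + 1 + 1),
        ((m + 1).choose k : ℚ) * bernoulli k * bernoulli (m + 1 - k)
      = -m * bernoulli (m + 1) - (m + 1) * bernoulli m := by
  have h := congrArg (PowerSeries.coeff (m + 1)) X_mul_derivative_bernoulliPowerSeries
  simp only [map_add, PowerSeries.coeff_succ_X_mul, PowerSeries.coeff_derivative] at h
  simp only [PowerSeries.coeff_mul, bernoulliPowerSeries, PowerSeries.coeff_mk, Algebra.algebraMap_self,
    RingHom.id_apply, Finset.Nat.sum_antidiagonal_eq_sum_range_succ_mk] at h
  have hsum : ∑ k ∈ Finset.range (m + 1 + 1),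
        ((m + 1).choose k : ℚ) * bernoulli k * bernoulli (m + 1 - k)
      = ((m + 1).factorial : ℚ) * ∑ k ∈ Finset.range (m + 1 + 1),
        bernoulli k / k.factorial * (bernoulli (m + 1 - k) / (m + 1 - k).factorial) := by
    rw [Finset.mul_sum]
    refine Finset.sum_congr rfl fun k hk => ?_
    rw [Nat.cast_choose ℚ (Finset.mem_range_succ_iff.mp hk)]
    ring
  rw [hsum, ← sub_eq_iff_eq_add'.mpr h.symm, Nat.factorial_succ]
  push_cast
  field_simp
  ring

/-- **Euler's identity.** For every integer `n ≥ 1`, the Bernoulli numbers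
(with `B₁ = -1/2`) satisfy `B_n = -B_{n-1} - (1/n) ∑_{k=1}^{n} C(n,k) B_k B_{n-k}`. -/
theorem bernoulli_euler_identity (n : ℕ) (hn : 1 ≤ n) :
    bernoulli n
      = -bernoulli (n - 1)
        - (1 / (n : ℚ)) * ∑ k ∈ Finset.Icc 1 n,
            (n.choose k : ℚ) * bernoulli k * bernoulli (n - k) := by
  obtain ⟨m, rfl⟩ := Nat.exists_eq_add_of_le' hn
  have h := sum_choose_mul_bernoulli_mul_bernoulli m
  rw [Finset.range_eq_Ico, Finset.sum_eq_sum_Ico_succ_bot (by omega)] at h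
  simp only [Nat.choose_zero_right, bernoulli_zero, Nat.sub_zero, Nat.cast_one, one_mul,
    zero_add] at h
  rw [← Finset.Ico_add_one_right_eq_Icc, eq_sub_of_add_eq' h, Nat.add_sub_cancel]
  push_cast
  field_simp
  ring
end

section
/- For every integer n ≥ 1 and all s, t, the Bernoulli polynomials satisfy the convolution identity ∑_{k=0}^{n} C(n,k) B_k(s) B_{n-k}(t) = n(s + t - 1) B_{n-1}(s+t) - (n-1) B_n(s+t). -/
/-- The exponential generating function of the Bernoulli polynomials, evaluated at `s`. -/
noncomputable def bernoulliEGF (s : ℝ) : PowerSeries ℝ :=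
  PowerSeries.mk fun n => bernoulliPolyEval n s / (n.factorial : ℝ)

theorem bernoulliEGF_mul_exp_sub_one (s : ℝ) :
    bernoulliEGF s * (PowerSeries.exp ℝ - 1) =
      PowerSeries.X * PowerSeries.rescale s (PowerSeries.exp ℝ) := by
  rw [← Polynomial.bernoulli_generating_function s]
  congr 1
  ext n
  simp [bernoulliEGF, bernoulliPolyEval, div_eq_inv_mul, Algebra.smul_def]

theorem derivative_rescale_exp_s4 (s : ℝ) :
    PowerSeries.derivative ℝ (PowerSeries.rescale s (PowerSeries.exp ℝ)) =
      PowerSeries.C s * PowerSeries.rescale s (PowerSeries.exp ℝ) := by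
  ext n
  have h : (n.factorial : ℝ) ≠ 0 := by positivity
  have h' : (n : ℝ) + 1 ≠ 0 := by positivity
  simp [PowerSeries.coeff_derivative, PowerSeries.coeff_exp, Nat.factorial_succ]
  field_simp
  ring

theorem exp_sub_one_ne_zero : PowerSeries.exp ℝ - 1 ≠ 0 := by
  intro h
  have := congrArg (PowerSeries.coeff 1) h
  simp [PowerSeries.coeff_exp, PowerSeries.coeff_one] at this

theorem bernoulliEGF_mul (s t : ℝ) :
    bernoulliEGF s * bernoulliEGF t =
      PowerSeries.C (s + t - 1) * (PowerSeries.X * bernoulliEGF (s + t)) -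
        PowerSeries.X * PowerSeries.derivative ℝ (bernoulliEGF (s + t)) +
        bernoulliEGF (s + t) := by
  have hs := bernoulliEGF_mul_exp_sub_one s
  have ht := bernoulliEGF_mul_exp_sub_one t
  have hu := bernoulliEGF_mul_exp_sub_one (s + t)
  have he := PowerSeries.exp_mul_exp_eq_exp_add s t
  have hd := congrArg (PowerSeries.derivative ℝ) hu
  have hexp : PowerSeries.derivative ℝ (PowerSeries.exp ℝ) = PowerSeries.exp ℝ :=
    PowerSeries.derivative_exp ℝ
  simp only [Derivation.leibniz, map_sub, hexp, derivative_rescale_exp_s4, smul_eq_mul,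
    Derivation.map_one_eq_zero, sub_zero, PowerSeries.derivative_X, mul_one] at hd
  apply mul_right_cancel₀ (pow_ne_zero 2 exp_sub_one_ne_zero)
  have hC : (PowerSeries.C (s + t - 1) : PowerSeries ℝ) = PowerSeries.C (s + t) - 1 := by
    simp
  rw [hC]
  generalize PowerSeries.C (s + t) = c at *
  generalize PowerSeries.rescale (s + t) (PowerSeries.exp ℝ) = eu at *
  generalize PowerSeries.rescale s (PowerSeries.exp ℝ) = es at *
  generalize PowerSeries.rescale t (PowerSeries.exp ℝ) = et at *
  generalize PowerSeries.derivative ℝ (bernoulliEGF (s + t)) = G' at *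
  generalize bernoulliEGF (s + t) = G at *
  generalize bernoulliEGF s = S at *
  generalize bernoulliEGF t = T at *
  generalize PowerSeries.exp ℝ = E at *
  generalize (PowerSeries.X : PowerSeries ℝ) = x at *
  have h1 : S * T * (E - 1) ^ 2 = x ^ 2 * eu := by
    rw [← he]; linear_combination T * (E - 1) * hs + x * es * ht
  rw [h1]
  linear_combination x * (E - 1) * hd - (c - 1) * x * (E - 1) * hu - x * E * hu - (E - 1) * hu

/-- For every integer `n ≥ 1` and all `s`, `t`,
`∑_{k=0}^{n} C(n,k) B_k(s) B_{n-k}(t) = n(s+t-1) B_{n-1}(s+t) - (n-1) B_n(s+t)`. -/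
theorem bernoulliPoly_convolution (n : ℕ) (hn : 1 ≤ n) (s t : ℝ) :
    ∑ k ∈ Finset.range (n + 1),
        (n.choose k : ℝ) * bernoulliPolyEval k s * bernoulliPolyEval (n - k) t
      = (n : ℝ) * (s + t - 1) * bernoulliPolyEval (n - 1) (s + t)
        - ((n : ℝ) - 1) * bernoulliPolyEval n (s + t) := by
  obtain ⟨m, rfl⟩ : ∃ m, n = m + 1 := ⟨n - 1, by omega⟩
  have h := congrArg (PowerSeries.coeff (m + 1)) (bernoulliEGF_mul s t)
  rw [PowerSeries.coeff_mul, Finset.Nat.sum_antidiagonal_eq_sum_range_succ_mk] at h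
  simp only [LinearMap.map_add, LinearMap.map_sub, PowerSeries.coeff_C_mul, PowerSeries.coeff_succ_X_mul,
    PowerSeries.coeff_derivative, bernoulliEGF, PowerSeries.coeff_mk] at h
  have hm : (m.factorial : ℝ) ≠ 0 := by positivity
  have hm' : (m : ℝ) + 1 ≠ 0 := by positivity
  have hsum : ∑ k ∈ Finset.range (m + 1 + 1),
        ((m + 1).choose k : ℝ) * bernoulliPolyEval k s * bernoulliPolyEval (m + 1 - k) t =
      ((m + 1).factorial : ℝ) * ∑ k ∈ Finset.range (m + 1 + 1),
        bernoulliPolyEval k s / (k.factorial : ℝ) *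
          (bernoulliPolyEval (m + 1 - k) t / ((m + 1 - k).factorial : ℝ)) := by
    rw [Finset.mul_sum]
    refine Finset.sum_congr rfl fun k hk => ?_
    rw [Nat.cast_choose ℝ (Finset.mem_range_succ_iff.mp hk)]
    field_simp
  rw [hsum, h, Nat.factorial_succ]
  push_cast
  field_simp
  ring
end
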